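/- arXiv:1902.00580 — 3 statements merged into one kernel-verified Lean document; each statement's English description precedes it below -/
import Mathlib

section
/- Let (X, Y, Z) be finite-alphabet stochastic processes on a common probability space that are jointly stationary, jointly d-Markov, and satisfy assumption (A1). If the causally conditioned directed information satisfies I(Y^n → X^n || Z^n) = 0 for every n ≥ 1, then X is conditionally d-Markov given Z, i.e., for every i, H(X_i | X^{i−1}, Z^i) = H(X_i | X_{i−d}^{i−1}, Z_{i−d}^i). -/
open MeasureTheory Finset

noncomputable section

variable {Ω : Type*}

/-- Windowed history `(X_{max(a,1)}, …, X_b)` of a process `X = (X_i)_{i ≥ 1}`, encoded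
uniformly as a map `ℕ → Option α`; indices outside the window `[max(a,1), b]` (in
particular, indices below `1`) are dropped (set to `none`). -/
def blk {α : Type*} (X : ℕ → Ω → α) (a b : ℕ) : Ω → (ℕ → Option α) :=
  fun ω j => if max a 1 ≤ j ∧ j ≤ b then some (X j ω) else none

/-- Shannon entropy `H(U)` of a random variable `U`. -/
def ent [MeasurableSpace Ω] {β : Type*} (μ : Measure Ω) (U : Ω → β) : ℝ :=
  -∑' b : β, (μ (U ⁻¹' {b})).toReal * Real.log (μ (U ⁻¹' {b})).toReal

/-- Conditional Shannon entropy `H(U ∣ V)`. -/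
def condEnt [MeasurableSpace Ω] {β γ : Type*} (μ : Measure Ω) (U : Ω → β) (V : Ω → γ) : ℝ :=
  ent μ (fun ω => (U ω, V ω)) - ent μ V

/-- Conditional mutual information `I(U ; V ∣ W) = H(U ∣ W) - H(U ∣ V, W)`. -/
def cmi [MeasurableSpace Ω] {β γ δ : Type*} (μ : Measure Ω) (U : Ω → β) (V : Ω → γ)
    (W : Ω → δ) : ℝ :=
  condEnt μ U W - condEnt μ U (fun ω => (V ω, W ω))

/-- `U` and `V` are conditionally independent given `W` (under `μ`). -/
def CondIndepRV [MeasurableSpace Ω] {β γ δ : Type*} (μ : Measure Ω) (U : Ω → β) (V : Ω → γ)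
    (W : Ω → δ) : Prop :=
  ∀ (b : β) (c : γ) (w : δ),
    μ (U ⁻¹' {b} ∩ V ⁻¹' {c} ∩ W ⁻¹' {w}) * μ (W ⁻¹' {w})
      = μ (U ⁻¹' {b} ∩ W ⁻¹' {w}) * μ (V ⁻¹' {c} ∩ W ⁻¹' {w})

variable {𝒳 𝒴 𝒵 : Type*}

/-- The joint past window `(X_{i-d}^{i-1}, Y_{i-d}^{i-1}, Z_{i-d}^{i-1})`. -/
def past (X : ℕ → Ω → 𝒳) (Y : ℕ → Ω → 𝒴) (Z : ℕ → Ω → 𝒵) (d i : ℕ) :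
    Ω → (ℕ → Option 𝒳) × (ℕ → Option 𝒴) × (ℕ → Option 𝒵) :=
  fun ω => (blk X (i - d) (i - 1) ω, blk Y (i - d) (i - 1) ω, blk Z (i - d) (i - 1) ω)

/-- `(X, Y, Z)` are jointly `d`-Markov: for every `i`, `(X_i, Y_i, Z_i)` is conditionally
independent of `(X^{i-d-1}, Y^{i-d-1}, Z^{i-d-1})` given
`(X_{i-d}^{i-1}, Y_{i-d}^{i-1}, Z_{i-d}^{i-1})`. -/
def JointlyMarkov [MeasurableSpace Ω] (μ : Measure Ω) (X : ℕ → Ω → 𝒳) (Y : ℕ → Ω → 𝒴)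
    (Z : ℕ → Ω → 𝒵) (d : ℕ) : Prop :=
  ∀ i : ℕ, 1 ≤ i →
    CondIndepRV μ (fun ω => (X i ω, Y i ω, Z i ω))
      (fun ω => (blk X 1 (i - d - 1) ω, blk Y 1 (i - d - 1) ω, blk Z 1 (i - d - 1) ω))
      (past X Y Z d i)

/-- `(X, Y, Z)` are jointly stationary: all finite-dimensional joint distributions are
invariant under index shifts. -/
def JointlyStationary [MeasurableSpace Ω] (μ : Measure Ω) (X : ℕ → Ω → 𝒳) (Y : ℕ → Ω → 𝒴)
    (Z : ℕ → Ω → 𝒵) : Prop :=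
  ∀ (n : ℕ) (t : Fin n → ℕ) (a : Fin n → 𝒳 × 𝒴 × 𝒵), (∀ j, 1 ≤ t j) →
    μ (⋂ j, {ω | (X (t j) ω, Y (t j) ω, Z (t j) ω) = a j})
      = μ (⋂ j, {ω | (X (t j + 1) ω, Y (t j + 1) ω, Z (t j + 1) ω) = a j})

/-- Assumption (A1): for every `i`, the variables `X_i, Y_i, Z_i` are mutually conditionally
independent given the joint past `(X_{i-d}^{i-1}, Y_{i-d}^{i-1}, Z_{i-d}^{i-1})` (all pairwise
factorizations together with the triple factorization). -/
def A1 [MeasurableSpace Ω] (μ : Measure Ω) (X : ℕ → Ω → 𝒳) (Y : ℕ → Ω → 𝒴)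
    (Z : ℕ → Ω → 𝒵) (d : ℕ) : Prop :=
  ∀ i : ℕ, 1 ≤ i →
    CondIndepRV μ (X i) (Y i) (past X Y Z d i) ∧
    CondIndepRV μ (X i) (Z i) (past X Y Z d i) ∧
    CondIndepRV μ (Y i) (Z i) (past X Y Z d i) ∧
    ∀ (a : 𝒳) (b : 𝒴) (c : 𝒵)
      (w : (ℕ → Option 𝒳) × (ℕ → Option 𝒴) × (ℕ → Option 𝒵)),
      μ (X i ⁻¹' {a} ∩ Y i ⁻¹' {b} ∩ Z i ⁻¹' {c} ∩ past X Y Z d i ⁻¹' {w})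
          * μ (past X Y Z d i ⁻¹' {w}) * μ (past X Y Z d i ⁻¹' {w})
        = μ (X i ⁻¹' {a} ∩ past X Y Z d i ⁻¹' {w})
          * μ (Y i ⁻¹' {b} ∩ past X Y Z d i ⁻¹' {w})
          * μ (Z i ⁻¹' {c} ∩ past X Y Z d i ⁻¹' {w})

/-- The causally conditioned directed information
`I(Y^n → X^n ‖ Z^n) = ∑_{i=1}^n I(X_i ; Y^i ∣ X^{i-1}, Z^i)`. -/
def DI [MeasurableSpace Ω] (μ : Measure Ω) (X : ℕ → Ω → 𝒳) (Y : ℕ → Ω → 𝒴)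
    (Z : ℕ → Ω → 𝒵) (n : ℕ) : ℝ :=
  ∑ i ∈ Finset.Icc 1 n,
    cmi μ (X i) (blk Y 1 i) (fun ω => (blk X 1 (i - 1) ω, blk Z 1 i ω))

/-- The `k`-th order causally conditioned truncated directed information
`I_T^{(k)}(Y^n → X^n ‖ Z^n) = ∑_{i=1}^n I(X_i ; Y_{i-k}^i ∣ X_{i-k}^{i-1}, Z_{i-k}^i)`. -/
def TDI [MeasurableSpace Ω] (μ : Measure Ω) (X : ℕ → Ω → 𝒳) (Y : ℕ → Ω → 𝒴)
    (Z : ℕ → Ω → 𝒵) (k n : ℕ) : ℝ :=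
  ∑ i ∈ Finset.Icc 1 n,
    cmi μ (X i) (blk Y (i - k) i)
      (fun ω => (blk X (i - k) (i - 1) ω, blk Z (i - k) i ω))

/-- The `k`-th order causally conditioned partial directed information
`I_P^{(k)}(Y^n → X^n ‖ Z^n) = ∑_{i=1}^n I(X_i ; Y_{i-k}^i ∣ X^{i-1}, Y^{i-k-1}, Z^i)`. -/
def PDI [MeasurableSpace Ω] (μ : Measure Ω) (X : ℕ → Ω → 𝒳) (Y : ℕ → Ω → 𝒴)
    (Z : ℕ → Ω → 𝒵) (k n : ℕ) : ℝ :=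
  ∑ i ∈ Finset.Icc 1 n,
    cmi μ (X i) (blk Y (i - k) i)
      (fun ω => (blk X 1 (i - 1) ω, blk Y 1 (i - k - 1) ω, blk Z 1 i ω))

section FiniteValued

variable [MeasurableSpace Ω] {β γ δ : Type*}

/-- A random variable with finitely many values, all of whose fibers are measurable. -/
structure IsFiniteValued (U : Ω → β) : Prop where
  finite_range : (Set.range U).Finite
  measurableSet_fiber : ∀ b, MeasurableSet (U ⁻¹' {b})

namespace IsFiniteValued

theorem of_measurable [MeasurableSpace β] [MeasurableSingletonClass β] [Finite β] {U : Ω → β}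
    (hU : Measurable U) : IsFiniteValued U :=
  ⟨Set.toFinite _, fun b => hU (measurableSet_singleton b)⟩

theorem prodMk {U : Ω → β} {V : Ω → γ} (hU : IsFiniteValued U) (hV : IsFiniteValued V) :
    IsFiniteValued (fun ω => (U ω, V ω)) := by
  refine ⟨(hU.1.prod hV.1).subset ?_, fun b => ?_⟩
  · rintro _ ⟨ω, rfl⟩
    exact ⟨⟨ω, rfl⟩, ⟨ω, rfl⟩⟩
  · convert (hU.2 b.1).inter (hV.2 b.2) using 1
    ext ω
    simp [Prod.ext_iff]

theorem comp {U : Ω → β} (hU : IsFiniteValued U) (g : β → γ) :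
    IsFiniteValued (fun ω => g (U ω)) := by
  have hr : (Set.range fun ω => g (U ω)) = g '' Set.range U := Set.range_comp g U
  refine ⟨hr ▸ hU.1.image g, fun c => ?_⟩
  have hc : (fun ω => g (U ω)) ⁻¹' {c} = ⋃ b ∈ Set.range U ∩ g ⁻¹' {c}, U ⁻¹' {b} := by
    ext ω
    simp
  rw [hc]
  exact (hU.1.inter_of_left _).measurableSet_biUnion fun b _ => hU.2 b

theorem blk {α : Type*} [MeasurableSpace α] [MeasurableSingletonClass α] [Finite α]
    {X : ℕ → Ω → α} (hX : ∀ i, Measurable (X i)) (a b : ℕ) : IsFiniteValued (blk X a b) := by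
  classical
  have hT : IsFiniteValued (fun ω (j : Fin (b + 1)) => X j ω) :=
    of_measurable (measurable_pi_lambda _ fun j => hX j)
  convert hT.comp (fun (t : Fin (b + 1) → α) (j : ℕ) =>
    if h : max a 1 ≤ j ∧ j ≤ b then some (t ⟨j, by omega⟩) else none) using 1
  funext ω j
  simp only [_root_.blk]
  split_ifs <;> rfl

theorem measure_comp_preimage_inter {μ : Measure Ω} {U : Ω → β} (hU : IsFiniteValued U)
    (g : β → γ) (c : γ) {A : Set Ω} (hA : MeasurableSet A) [DecidableEq γ] :
    μ ((fun ω => g (U ω)) ⁻¹' {c} ∩ A)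
      = ∑ b ∈ hU.finite_range.toFinset with g b = c, μ (U ⁻¹' {b} ∩ A) := by
  rw [← measure_biUnion_finset]
  · congr 1
    ext ω
    simp only [Set.mem_inter_iff, Set.mem_preimage, Set.mem_singleton_iff, Set.mem_iUnion,
      Finset.mem_filter, Set.Finite.mem_toFinset, Set.mem_range, exists_prop]
    constructor
    · rintro ⟨h, hω⟩
      exact ⟨U ω, ⟨⟨ω, rfl⟩, h⟩, rfl, hω⟩
    · rintro ⟨b, ⟨-, h⟩, rfl, hω⟩
      exact ⟨h, hω⟩
  · intro b _ b' _ hbb'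
    refine Set.disjoint_left.2 fun ω h h' => hbb' ?_
    exact h.1.symm.trans h'.1
  · exact fun b _ => (hU.2 b).inter hA

variable {μ : Measure Ω} [IsFiniteMeasure μ] {U : Ω → β}

theorem comp_eq_sum_indicator (hU : IsFiniteValued U) (f : β → ℝ) :
    (fun ω => f (U ω)) =
      fun ω => ∑ b ∈ hU.finite_range.toFinset, (U ⁻¹' {b}).indicator (fun _ => f b) ω := by
  funext ω
  rw [Finset.sum_eq_single (U ω)]
  · simp
  · intro b _ hb
    simp [hb.symm]
  · simp

theorem integrable_comp (hU : IsFiniteValued U) (f : β → ℝ) :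
    Integrable (fun ω => f (U ω)) μ := by
  rw [hU.comp_eq_sum_indicator f]
  exact integrable_finsetSum _ fun b _ => (integrable_const _).indicator (hU.2 b)

theorem integral_comp (hU : IsFiniteValued U) (f : β → ℝ) :
    ∫ ω, f (U ω) ∂μ = ∑ b ∈ hU.finite_range.toFinset, μ.real (U ⁻¹' {b}) * f b := by
  rw [hU.comp_eq_sum_indicator f, integral_finsetSum]
  · refine Finset.sum_congr rfl fun b _ => ?_
    rw [integral_indicator_const _ (hU.2 b), smul_eq_mul]
  · exact fun b _ => (integrable_const _).indicator (hU.2 b)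

theorem ae_fiber_pos (hU : IsFiniteValued U) : ∀ᵐ ω ∂μ, 0 < μ.real (U ⁻¹' {U ω}) := by
  have hnull : μ (⋃ b ∈ Set.range U ∩ {b | μ (U ⁻¹' {b}) = 0}, U ⁻¹' {b}) = 0 :=
    (measure_biUnion_null_iff (hU.1.inter_of_left _).countable).2 fun b hb => hb.2
  filter_upwards [measure_eq_zero_iff_ae_notMem.1 hnull] with ω hω
  refine ENNReal.toReal_pos (fun h => hω ?_) (measure_ne_top _ _)
  simpa using h

/-- Entropy as the expected information content of the fiber through the sample point. -/
theorem ent_eq_integral (hU : IsFiniteValued U) :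
    ent μ U = -∫ ω, Real.log (μ.real (U ⁻¹' {U ω})) ∂μ := by
  rw [hU.integral_comp (fun b => Real.log (μ.real (U ⁻¹' {b}))), ent, tsum_eq_sum]
  · rfl
  · intro b hb
    have : U ⁻¹' {b} = ∅ := by
      rw [Set.preimage_singleton_eq_empty]
      simpa using hb
    simp [this]

/-- Entropy only depends on the partition of the sample space into fibers. -/
theorem ent_congr {V : Ω → γ} (hU : IsFiniteValued U) (hV : IsFiniteValued V)
    (h : ∀ ω ω', U ω = U ω' ↔ V ω = V ω') : ent μ U = ent μ V := by
  rw [hU.ent_eq_integral, hV.ent_eq_integral]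
  have : ∀ ω, U ⁻¹' {U ω} = V ⁻¹' {V ω} := fun ω => Set.ext fun ω' => h ω' ω
  simp only [this]

theorem ent_add_ent_of_condIndepRV {V : Ω → γ} {W : Ω → δ} (hU : IsFiniteValued U)
    (hV : IsFiniteValued V) (hW : IsFiniteValued W) (h : CondIndepRV μ U V W) :
    ent μ (fun ω => (U ω, V ω, W ω)) + ent μ W
      = ent μ (fun ω => (U ω, W ω)) + ent μ (fun ω => (V ω, W ω)) := by
  have hUVW := hU.prodMk (hV.prodMk hW)
  have hUW := hU.prodMk hW
  have hVW := hV.prodMk hW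
  have integrable_logW : Integrable (fun ω => Real.log (μ.real (W ⁻¹' {W ω}))) μ :=
    hW.integrable_comp fun b => Real.log (μ.real (W ⁻¹' {b}))
  have integrable_logUW := hUW.integrable_comp (μ := μ)
    fun b => Real.log (μ.real ((fun ω => (U ω, W ω)) ⁻¹' {b}))
  have integrable_logVW := hVW.integrable_comp (μ := μ)
    fun b => Real.log (μ.real ((fun ω => (V ω, W ω)) ⁻¹' {b}))
  have integrable_logUVW := hUVW.integrable_comp (μ := μ)
    fun b => Real.log (μ.real ((fun ω => (U ω, V ω, W ω)) ⁻¹' {b}))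
  rw [hUVW.ent_eq_integral, hW.ent_eq_integral, hUW.ent_eq_integral, hVW.ent_eq_integral,
    ← neg_add, ← neg_add, ← integral_add integrable_logUVW integrable_logW,
    ← integral_add integrable_logUW integrable_logVW]
  congr 1
  refine integral_congr_ae ?_
  filter_upwards [hUVW.ae_fiber_pos (μ := μ), hUW.ae_fiber_pos (μ := μ),
    hVW.ae_fiber_pos (μ := μ), hW.ae_fiber_pos (μ := μ)] with ω h₁ h₂ h₃ h₄
  rw [← Real.log_mul h₁.ne' h₄.ne', ← Real.log_mul h₂.ne' h₃.ne']
  have hω := congrArg ENNReal.toReal (h (U ω) (V ω) (W ω))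
  rw [ENNReal.toReal_mul, ENNReal.toReal_mul, Set.inter_assoc] at hω
  have e₁ : (fun ω => (U ω, V ω, W ω)) ⁻¹' {(U ω, V ω, W ω)}
      = U ⁻¹' {U ω} ∩ (V ⁻¹' {V ω} ∩ W ⁻¹' {W ω}) := by ext; simp
  have e₂ : (fun ω => (U ω, W ω)) ⁻¹' {(U ω, W ω)} = U ⁻¹' {U ω} ∩ W ⁻¹' {W ω} := by ext; simp
  have e₃ : (fun ω => (V ω, W ω)) ⁻¹' {(V ω, W ω)} = V ⁻¹' {V ω} ∩ W ⁻¹' {W ω} := by ext; simp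
  rw [e₁, e₂, e₃]
  exact congrArg Real.log hω

end IsFiniteValued

theorem CondIndepRV.comp_left {ε : Type*} {μ : Measure Ω} [IsFiniteMeasure μ] {U : Ω → β}
    {V : Ω → γ} {W : Ω → δ} (h : CondIndepRV μ U V W) (hU : IsFiniteValued U)
    (hV : IsFiniteValued V) (hW : IsFiniteValued W) (g : β → ε) :
    CondIndepRV μ (fun ω => g (U ω)) V W := by
  classical
  intro e c w
  rw [Set.inter_assoc, hU.measure_comp_preimage_inter g e ((hV.2 c).inter (hW.2 w)),
    hU.measure_comp_preimage_inter g e (hW.2 w), Finset.sum_mul, Finset.sum_mul]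
  refine Finset.sum_congr rfl fun b _ => ?_
  rw [← Set.inter_assoc]
  exact h b c w

theorem ent_comp_eq_of_map_eq {μ : Measure Ω} [MeasurableSpace β] [DiscreteMeasurableSpace β]
    {S T : Ω → β} (hS : Measurable S) (hT : Measurable T) (h : μ.map S = μ.map T) (F : β → γ) :
    ent μ (fun ω => F (S ω)) = ent μ (fun ω => F (T ω)) := by
  have hfiber : ∀ c, μ ((fun ω => F (S ω)) ⁻¹' {c}) = μ ((fun ω => F (T ω)) ⁻¹' {c}) := by
    intro c
    have hc := congrArg (fun ν => ν (F ⁻¹' {c})) h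
    rwa [Measure.map_apply hS (MeasurableSet.of_discrete),
      Measure.map_apply hT (MeasurableSet.of_discrete)] at hc
  simp only [ent, hfiber]

end FiniteValued

theorem blk_eq_blk_iff {α : Type*} {X : ℕ → Ω → α} {a b : ℕ} {ω ω' : Ω} :
    blk X a b ω = blk X a b ω' ↔ ∀ j, a ≤ j → 1 ≤ j → j ≤ b → X j ω = X j ω' := by
  simp only [funext_iff, blk]
  refine forall_congr' fun j => ?_
  by_cases h : max a 1 ≤ j ∧ j ≤ b
  · have := max_le_iff.1 h.1
    simp [h, this]
  · simp only [h, if_false, true_iff]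
    intro h₁ h₂ h₃
    exact absurd ⟨max_le h₁ h₂, h₃⟩ h

theorem blk_eq_blk_iff_forall_fin {α : Type*} {V : ℕ → Ω → α} {s n : ℕ} {ω ω' : Ω} :
    blk V (s + 1) (s + n) ω = blk V (s + 1) (s + n) ω'
      ↔ ∀ j : Fin n, V (s + 1 + j) ω = V (s + 1 + j) ω' := by
  rw [blk_eq_blk_iff]
  constructor
  · exact fun h j => h _ (by omega) (by omega) (by omega)
  · intro h j h₁ _ h₃
    have := h ⟨j - (s + 1), by omega⟩
    rwa [show s + 1 + (j - (s + 1)) = j by omega] at this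

theorem blk_one_eq_blk_one_iff {α : Type*} {V : ℕ → Ω → α} {d i : ℕ} {ω ω' : Ω} :
    blk V 1 (i - 1) ω = blk V 1 (i - 1) ω' ↔
      blk V 1 (i - d - 1) ω = blk V 1 (i - d - 1) ω' ∧
        blk V (i - d) (i - 1) ω = blk V (i - d) (i - 1) ω' := by
  simp only [blk_eq_blk_iff]
  constructor
  · exact fun h => ⟨fun j _ _ _ => h j (by omega) (by omega) (by omega),
      fun j _ _ _ => h j (by omega) (by omega) (by omega)⟩
  · rintro ⟨h₁, h₂⟩ j _ _ _
    by_cases hj : j ≤ i - d - 1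
    · exact h₁ j (by omega) (by omega) hj
    · exact h₂ j (by omega) (by omega) (by omega)

theorem blk_eq_blk_iff_and_last {α : Type*} {V : ℕ → Ω → α} {a i : ℕ} (hi : 1 ≤ i) (ha : a ≤ i)
    {ω ω' : Ω} :
    blk V a i ω = blk V a i ω' ↔
      V i ω = V i ω' ∧ blk V a (i - 1) ω = blk V a (i - 1) ω' := by
  simp only [blk_eq_blk_iff]
  constructor
  · exact fun h => ⟨h i ha hi le_rfl, fun j _ _ _ => h j (by omega) (by omega) (by omega)⟩
  · rintro ⟨h₁, h₂⟩ j _ _ _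
    rcases eq_or_ne j i with rfl | hj
    · exact h₁
    · exact h₂ j (by omega) (by omega) (by omega)

theorem cmi_eq_zero_of_DI_eq_zero [MeasurableSpace Ω] {μ : Measure Ω} {X : ℕ → Ω → 𝒳}
    {Y : ℕ → Ω → 𝒴} {Z : ℕ → Ω → 𝒵} (hDI : ∀ n : ℕ, 1 ≤ n → DI μ X Y Z n = 0)
    {i : ℕ} (hi : 1 ≤ i) :
    cmi μ (X i) (blk Y 1 i) (fun ω => (blk X 1 (i - 1) ω, blk Z 1 i ω)) = 0 := by
  obtain ⟨n, rfl⟩ : ∃ n, i = n + 1 := ⟨i - 1, by omega⟩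
  have hsucc := hDI (n + 1) hi
  rw [DI, Finset.sum_Icc_succ_top hi, ← DI] at hsucc
  have hn : DI μ X Y Z n = 0 := by
    rcases Nat.eq_zero_or_pos n with rfl | hn
    · simp [DI]
    · exact hDI n hn
  rwa [hn, zero_add] at hsucc

/-- The joint window `(X, Y, Z)_{s+1}^{s+n}` as a tuple. -/
def window (X : ℕ → Ω → 𝒳) (Y : ℕ → Ω → 𝒴) (Z : ℕ → Ω → 𝒵) (n s : ℕ) (ω : Ω) :
    Fin n → 𝒳 × 𝒴 × 𝒵 :=
  fun j => (X (s + 1 + j) ω, Y (s + 1 + j) ω, Z (s + 1 + j) ω)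

theorem measurable_window [MeasurableSpace Ω] [MeasurableSpace 𝒳] [MeasurableSpace 𝒴]
    [MeasurableSpace 𝒵] {X : ℕ → Ω → 𝒳} {Y : ℕ → Ω → 𝒴} {Z : ℕ → Ω → 𝒵}
    (hX : ∀ i, Measurable (X i)) (hY : ∀ i, Measurable (Y i))
    (hZ : ∀ i, Measurable (Z i)) (n s : ℕ) : Measurable (window X Y Z n s) :=
  measurable_pi_lambda _ fun _ => (hX _).prodMk ((hY _).prodMk (hZ _))

section Processes

variable [MeasurableSpace Ω] {μ : Measure Ω}
  [MeasurableSpace 𝒳] [MeasurableSingletonClass 𝒳] [Fintype 𝒳]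
  [MeasurableSpace 𝒴] [MeasurableSingletonClass 𝒴] [Fintype 𝒴]
  [MeasurableSpace 𝒵] [MeasurableSingletonClass 𝒵] [Fintype 𝒵]
  {X : ℕ → Ω → 𝒳} {Y : ℕ → Ω → 𝒴} {Z : ℕ → Ω → 𝒵}

theorem JointlyStationary.map_window_eq (h : JointlyStationary μ X Y Z)
    (hX : ∀ i, Measurable (X i)) (hY : ∀ i, Measurable (Y i)) (hZ : ∀ i, Measurable (Z i))
    (n s : ℕ) : μ.map (window X Y Z n s) = μ.map (window X Y Z n 0) := by
  induction s with
  | zero => rfl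
  | succ s ih =>
    rw [← ih]
    refine Measure.ext_of_singleton fun a => ?_
    rw [Measure.map_apply (measurable_window hX hY hZ n _) (measurableSet_singleton a),
      Measure.map_apply (measurable_window hX hY hZ n _) (measurableSet_singleton a)]
    have key := h n (fun j => s + 1 + j) a fun j => by omega
    have fiber : ∀ s, window X Y Z n s ⁻¹' {a} = ⋂ j : Fin n,
        {ω | (X (s + 1 + j) ω, Y (s + 1 + j) ω, Z (s + 1 + j) ω) = a j} := by
      intro s
      ext ω
      simp [window, funext_iff]
    have shift : ∀ j : Fin n, s + 1 + 1 + (j : ℕ) = s + 1 + j + 1 := fun j => by omega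
    rw [fiber, fiber, key]
    simp only [shift]

variable [IsProbabilityMeasure μ]

/-- A variable that induces the same partition as a function of the window `(s, s + n]`, for every
`s`, has an entropy that does not depend on `s`. -/
theorem JointlyStationary.ent_eq {β γ : Type*} (h : JointlyStationary μ X Y Z)
    (hX : ∀ i, Measurable (X i)) (hY : ∀ i, Measurable (Y i)) (hZ : ∀ i, Measurable (Z i))
    (n : ℕ) (F : (Fin n → 𝒳 × 𝒴 × 𝒵) → γ) (U : ℕ → Ω → β) (hU : ∀ s, IsFiniteValued (U s))
    (hUF : ∀ s ω ω', U s ω = U s ω' ↔ F (window X Y Z n s ω) = F (window X Y Z n s ω'))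
    (s : ℕ) : ent μ (U s) = ent μ (U 0) := by
  have hwin := measurable_window hX hY hZ n
  have hF : ∀ s, IsFiniteValued fun ω => F (window X Y Z n s ω) := fun s =>
    (IsFiniteValued.of_measurable (hwin s)).comp F
  rw [(hU s).ent_congr (hF s) (hUF s), (hU 0).ent_congr (hF 0) (hUF 0)]
  exact ent_comp_eq_of_map_eq (hwin s) (hwin 0) (h.map_window_eq hX hY hZ n s) F

theorem JointlyStationary.condEnt_window_eq (h : JointlyStationary μ X Y Z)
    (hX : ∀ i, Measurable (X i)) (hY : ∀ i, Measurable (Y i)) (hZ : ∀ i, Measurable (Z i))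
    (d s : ℕ) :
    condEnt μ (X (s + d + 1))
        (fun ω => (blk X (s + 1) (s + d) ω, blk Z (s + 1) (s + (d + 1)) ω))
      = condEnt μ (X (0 + d + 1))
        (fun ω => (blk X (0 + 1) (0 + d) ω, blk Z (0 + 1) (0 + (d + 1)) ω)) := by
  have hblk : ∀ s, IsFiniteValued fun ω =>
      (blk X (s + 1) (s + d) ω, blk Z (s + 1) (s + (d + 1)) ω) := fun s =>
    (IsFiniteValued.blk hX _ _).prodMk (IsFiniteValued.blk hZ _ _)
  have hlast : ∀ s, s + 1 + d = s + d + 1 := fun s => by omega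
  unfold condEnt
  congr 1
  · refine h.ent_eq hX hY hZ (d + 1)
      (fun t => ((t (Fin.last d)).1, fun j : Fin d => (t j.castSucc).1, fun j => (t j).2.2))
      (fun s ω => (X (s + d + 1) ω, blk X (s + 1) (s + d) ω, blk Z (s + 1) (s + (d + 1)) ω))
      (fun s => (IsFiniteValued.of_measurable (hX _)).prodMk (hblk s)) (fun s ω ω' => ?_) s
    simp only [Prod.ext_iff, blk_eq_blk_iff_forall_fin]
    simp [funext_iff, window, hlast]
  · refine h.ent_eq hX hY hZ (d + 1)
      (fun t => (fun j : Fin d => (t j.castSucc).1, fun j => (t j).2.2))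
      (fun s ω => (blk X (s + 1) (s + d) ω, blk Z (s + 1) (s + (d + 1)) ω))
      hblk (fun s ω ω' => ?_) s
    simp only [Prod.ext_iff, blk_eq_blk_iff_forall_fin]
    simp [funext_iff, window]

theorem JointlyStationary.condEnt_joint_window_eq (h : JointlyStationary μ X Y Z)
    (hX : ∀ i, Measurable (X i)) (hY : ∀ i, Measurable (Y i)) (hZ : ∀ i, Measurable (Z i))
    (d s : ℕ) :
    condEnt μ (X (s + d + 1)) (fun ω => (blk Y (s + 1) (s + (d + 1)) ω,
        blk X (s + 1) (s + d) ω, blk Z (s + 1) (s + (d + 1)) ω))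
      = condEnt μ (X (0 + d + 1)) (fun ω => (blk Y (0 + 1) (0 + (d + 1)) ω,
        blk X (0 + 1) (0 + d) ω, blk Z (0 + 1) (0 + (d + 1)) ω)) := by
  have hblk : ∀ s, IsFiniteValued fun ω => (blk Y (s + 1) (s + (d + 1)) ω,
      blk X (s + 1) (s + d) ω, blk Z (s + 1) (s + (d + 1)) ω) := fun s =>
    (IsFiniteValued.blk hY _ _).prodMk
      ((IsFiniteValued.blk hX _ _).prodMk (IsFiniteValued.blk hZ _ _))
  have hlast : ∀ s, s + 1 + d = s + d + 1 := fun s => by omega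
  unfold condEnt
  congr 1
  · refine h.ent_eq hX hY hZ (d + 1)
      (fun t => ((t (Fin.last d)).1, fun j => (t j).2.1, fun j : Fin d => (t j.castSucc).1,
        fun j => (t j).2.2))
      (fun s ω => (X (s + d + 1) ω, blk Y (s + 1) (s + (d + 1)) ω, blk X (s + 1) (s + d) ω,
        blk Z (s + 1) (s + (d + 1)) ω))
      (fun s => (IsFiniteValued.of_measurable (hX _)).prodMk (hblk s)) (fun s ω ω' => ?_) s
    simp only [Prod.ext_iff, blk_eq_blk_iff_forall_fin]
    simp [funext_iff, window, hlast]
  · refine h.ent_eq hX hY hZ (d + 1)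
      (fun t => (fun j => (t j).2.1, fun j : Fin d => (t j.castSucc).1, fun j => (t j).2.2))
      (fun s ω => (blk Y (s + 1) (s + (d + 1)) ω, blk X (s + 1) (s + d) ω,
        blk Z (s + 1) (s + (d + 1)) ω))
      hblk (fun s ω ω' => ?_) s
    simp only [Prod.ext_iff, blk_eq_blk_iff_forall_fin]
    simp [funext_iff, window]

/-- For a jointly `d`-Markov process, only the last `d` steps of the past matter for the
conditional entropy of `X_i` given `(X^{i-1}, Y^i, Z^i)`. -/
theorem JointlyMarkov.condEnt_eq {d : ℕ} (h : JointlyMarkov μ X Y Z d)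
    (hX : ∀ i, Measurable (X i)) (hY : ∀ i, Measurable (Y i)) (hZ : ∀ i, Measurable (Z i))
    {i : ℕ} (hi : 1 ≤ i) :
    condEnt μ (X i) (fun ω => (blk Y 1 i ω, blk X 1 (i - 1) ω, blk Z 1 i ω))
      = condEnt μ (X i)
        (fun ω => (blk Y (i - d) i ω, blk X (i - d) (i - 1) ω, blk Z (i - d) i ω)) := by
  have hXi := IsFiniteValued.of_measurable (hX i)
  have hYZ : IsFiniteValued fun ω => (Y i ω, Z i ω) :=
    (IsFiniteValued.of_measurable (hY i)).prodMk (IsFiniteValued.of_measurable (hZ i))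
  have hpres : IsFiniteValued fun ω => (X i ω, Y i ω, Z i ω) := hXi.prodMk hYZ
  have hfar : IsFiniteValued fun ω =>
      (blk X 1 (i - d - 1) ω, blk Y 1 (i - d - 1) ω, blk Z 1 (i - d - 1) ω) :=
    (IsFiniteValued.blk hX _ _).prodMk
      ((IsFiniteValued.blk hY _ _).prodMk (IsFiniteValued.blk hZ _ _))
  have hpast : IsFiniteValued (past X Y Z d i) :=
    (IsFiniteValued.blk hX _ _).prodMk
      ((IsFiniteValued.blk hY _ _).prodMk (IsFiniteValued.blk hZ _ _))
  have hcond : ∀ a, IsFiniteValued fun ω => (blk Y a i ω, blk X a (i - 1) ω, blk Z a i ω) :=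
    fun a => (IsFiniteValued.blk hY _ _).prodMk
      ((IsFiniteValued.blk hX _ _).prodMk (IsFiniteValued.blk hZ _ _))
  have hXYZ := hpres.ent_add_ent_of_condIndepRV hfar hpast (h i hi)
  have hYZ' := hYZ.ent_add_ent_of_condIndepRV hfar hpast
    ((h i hi).comp_left hpres hfar hpast Prod.snd)
  have far_joint : ent μ (fun ω => (X i ω, blk Y 1 i ω, blk X 1 (i - 1) ω, blk Z 1 i ω)) = _ :=
    (hXi.prodMk (hcond 1)).ent_congr (hpres.prodMk (hfar.prodMk hpast)) fun ω ω' => by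
      simp only [Prod.ext_iff, past, blk_eq_blk_iff_and_last hi hi,
        blk_one_eq_blk_one_iff (d := d) (i := i)]
      tauto
  have far_cond : ent μ (fun ω => (blk Y 1 i ω, blk X 1 (i - 1) ω, blk Z 1 i ω)) = _ :=
    (hcond 1).ent_congr (hYZ.prodMk (hfar.prodMk hpast)) fun ω ω' => by
      simp only [Prod.ext_iff, past, blk_eq_blk_iff_and_last hi hi,
        blk_one_eq_blk_one_iff (d := d) (i := i)]
      tauto
  have near_joint : ent μ (fun ω =>
      (X i ω, blk Y (i - d) i ω, blk X (i - d) (i - 1) ω, blk Z (i - d) i ω)) = _ :=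
    (hXi.prodMk (hcond _)).ent_congr (hpres.prodMk hpast) fun ω ω' => by
      simp only [Prod.ext_iff, past, blk_eq_blk_iff_and_last hi (Nat.sub_le i d)]
      tauto
  have near_cond : ent μ (fun ω =>
      (blk Y (i - d) i ω, blk X (i - d) (i - 1) ω, blk Z (i - d) i ω)) = _ :=
    (hcond _).ent_congr (hYZ.prodMk hpast) fun ω ω' => by
      simp only [Prod.ext_iff, past, blk_eq_blk_iff_and_last hi (Nat.sub_le i d)]
      tauto
  unfold condEnt
  rw [far_joint, far_cond, near_joint, near_cond]
  linarith

end Processes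

/-- If `(X, Y, Z)` are jointly stationary, jointly `d`-Markov,
satisfy (A1), and the causally conditioned directed information
`I(Y^n → X^n ‖ Z^n)` vanishes for every `n ≥ 1`, then `X` is conditionally
`d`-Markov given `Z`: for every `i`,
`H(X_i ∣ X^{i-1}, Z^i) = H(X_i ∣ X_{i-d}^{i-1}, Z_{i-d}^i)`. -/
theorem zero_directed_info_implies_cond_markov
    [MeasurableSpace Ω] (μ : Measure Ω) [IsProbabilityMeasure μ]
    [MeasurableSpace 𝒳] [MeasurableSingletonClass 𝒳] [Fintype 𝒳]
    [MeasurableSpace 𝒴] [MeasurableSingletonClass 𝒴] [Fintype 𝒴]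
    [MeasurableSpace 𝒵] [MeasurableSingletonClass 𝒵] [Fintype 𝒵]
    (X : ℕ → Ω → 𝒳) (Y : ℕ → Ω → 𝒴) (Z : ℕ → Ω → 𝒵)
    (hX : ∀ i, Measurable (X i)) (hY : ∀ i, Measurable (Y i))
    (hZ : ∀ i, Measurable (Z i)) (d : ℕ)
    (hstat : JointlyStationary μ X Y Z)
    (hmarkov : JointlyMarkov μ X Y Z d)
    (hA1 : A1 μ X Y Z d)
    (hDI : ∀ n : ℕ, 1 ≤ n → DI μ X Y Z n = 0) :
    ∀ i : ℕ, 1 ≤ i →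
      condEnt μ (X i) (fun ω => (blk X 1 (i - 1) ω, blk Z 1 i ω))
        = condEnt μ (X i) (fun ω => (blk X (i - d) (i - 1) ω, blk Z (i - d) i ω)) := by
  intro i hi
  have hDI_eq : ∀ j : ℕ, 1 ≤ j →
      condEnt μ (X j) (fun ω => (blk X 1 (j - 1) ω, blk Z 1 j ω))
        = condEnt μ (X j) (fun ω => (blk Y 1 j ω, blk X 1 (j - 1) ω, blk Z 1 j ω)) :=
    fun j hj => sub_eq_zero.1 (cmi_eq_zero_of_DI_eq_zero hDI hj)
  rcases Nat.lt_or_ge d i with hdi | hid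
  · obtain ⟨s, rfl⟩ : ∃ s, i = s + d + 1 := ⟨i - d - 1, by omega⟩
    have near := hmarkov.condEnt_eq hX hY hZ hi
    have start := hDI_eq (d + 1) (by omega)
    have joint := hstat.condEnt_joint_window_eq hX hY hZ d s
    have cond := hstat.condEnt_window_eq hX hY hZ d s
    simp only [zero_add, ← add_assoc] at joint cond
    rw [show s + d + 1 - d = s + 1 by omega] at near ⊢
    rw [Nat.add_sub_cancel] at near start ⊢
    rw [cond, start, ← joint, ← near]
    exact hDI_eq (s + d + 1) hi
  · rw [Nat.sub_eq_zero_of_le hid]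
    rfl
end
end

section
/- Let (X, Y, Z) be finite-alphabet stochastic processes on a common probability space that are jointly d-Markov. Then for every i ≥ 1 and every k ≥ d, the per-time-step directed information term is bounded by the per-time-step truncated directed information term: I(X_i; Y^i | X^{i−1}, Z^i) ≤ H(X_i | X_{i−k}^{i−1}, Z_{i−k}^i) − H(X_i | X_{i−k}^{i−1}, Y_{i−k}^i, Z_{i−k}^i) = I(X_i; Y_{i−k}^i | X_{i−k}^{i−1}, Z_{i−k}^i). -/
open MeasureTheory Finset

noncomputable section

variable {Ω : Type*}

variable {𝒳 𝒴 𝒵 : Type*}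

theorem blk_eq_iff {β : Type*} {X : ℕ → Ω → β} {a b : ℕ} {ω ω' : Ω} :
    blk X a b ω = blk X a b ω' ↔ ∀ j, max a 1 ≤ j → j ≤ b → X j ω = X j ω' := by
  rw [funext_iff]
  refine forall_congr' fun j => ?_
  by_cases hj : max a 1 ≤ j ∧ j ≤ b
  · simp only [blk, if_pos hj, Option.some_inj]
    tauto
  · simp only [blk, if_neg hj]
    tauto

/-- A random variable with finitely many values and measurable fibres. -/
structure IsFinitelyValued [MeasurableSpace Ω] {β : Type*} (U : Ω → β) : Prop where
  finite_range : (Set.range U).Finite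
  measurableSet_fiber : ∀ b, MeasurableSet (U ⁻¹' {b})

section Entropy

variable [MeasurableSpace Ω] {β γ δ : Type*}

theorem IsFinitelyValued.prodMk {U : Ω → β} {V : Ω → γ} (hU : IsFinitelyValued U)
    (hV : IsFinitelyValued V) : IsFinitelyValued (fun ω => (U ω, V ω)) where
  finite_range := (hU.finite_range.prod hV.finite_range).subset <| by
    rintro _ ⟨ω, rfl⟩
    exact ⟨⟨ω, rfl⟩, ⟨ω, rfl⟩⟩
  measurableSet_fiber := by
    rintro ⟨b, c⟩
    convert (hU.measurableSet_fiber b).inter (hV.measurableSet_fiber c) using 1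
    ext ω
    simp

theorem IsFinitelyValued.of_measurable [MeasurableSpace β] [MeasurableSingletonClass β]
    [Finite β] {U : Ω → β} (hU : Measurable U) : IsFinitelyValued U where
  finite_range := Set.toFinite _
  measurableSet_fiber b := hU (measurableSet_singleton b)

theorem isFinitelyValued_blk [MeasurableSpace β] [MeasurableSingletonClass β] [Finite β]
    {X : ℕ → Ω → β} (hX : ∀ i, Measurable (X i)) (a b : ℕ) : IsFinitelyValued (blk X a b) where
  finite_range := by
    refine (Set.finite_range (fun (g : Fin (b + 1) → β) (j : ℕ) =>
      if h : max a 1 ≤ j ∧ j ≤ b then some (g ⟨j, by omega⟩) else none)).subset ?_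
    rintro _ ⟨ω, rfl⟩
    refine ⟨fun j => X j ω, ?_⟩
    funext j
    simp [blk]
  measurableSet_fiber c := by
    have h : blk X a b ⁻¹' {c} = ⋂ j, {ω | blk X a b ω j = c j} := by
      ext ω
      simp [funext_iff]
    rw [h]
    refine MeasurableSet.iInter fun j => ?_
    by_cases hj : max a 1 ≤ j ∧ j ≤ b
    · simp only [blk, if_pos hj]
      exact hX j (Set.toFinite {x | some x = c j}).measurableSet
    · simp only [blk, if_neg hj]
      exact MeasurableSet.const _

variable {μ : Measure Ω} [IsProbabilityMeasure μ]

theorem integral_comp_eq_sum {U : Ω → β} (hU : IsFinitelyValued U) {R : Finset β}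
    (hR : ∀ ω, U ω ∈ R) (g : β → ℝ) :
    ∫ ω, g (U ω) ∂μ = ∑ b ∈ R, μ.real (U ⁻¹' {b}) * g b := by
  classical
  have h : ∀ ω, g (U ω) = ∑ b ∈ R, (U ⁻¹' {b}).indicator (fun _ => g b) ω := by
    intro ω
    simp [Set.indicator_apply, hR ω]
  simp_rw [h]
  rw [integral_finsetSum _ fun b _ =>
    (integrable_const (g b)).indicator (hU.measurableSet_fiber b)]
  refine Finset.sum_congr rfl fun b _ => ?_
  rw [integral_indicator_const _ (hU.measurableSet_fiber b), smul_eq_mul]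

/-- Entropy as the expected information content. -/
theorem ent_eq_integral {U : Ω → β} (hU : IsFinitelyValued U) :
    ent μ U = -∫ ω, Real.log (μ.real (U ⁻¹' {U ω})) ∂μ := by
  have hR : ∀ ω, U ω ∈ hU.finite_range.toFinset := fun ω => by simp
  rw [integral_comp_eq_sum hU hR (fun b => Real.log (μ.real (U ⁻¹' {b}))), ent,
    tsum_eq_sum (s := hU.finite_range.toFinset)]
  · rfl
  · intro b hb
    have : U ⁻¹' {b} = ∅ := by
      ext ω
      simp only [Set.Finite.mem_toFinset, Set.mem_range, not_exists] at hb
      simpa using hb ω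
    simp [this]

theorem ent_congr {U : Ω → β} {V : Ω → γ} (hU : IsFinitelyValued U) (hV : IsFinitelyValued V)
    (h : ∀ ω ω', U ω = U ω' ↔ V ω = V ω') : ent μ U = ent μ V := by
  rw [ent_eq_integral hU, ent_eq_integral hV]
  congr! 6 with ω
  ext ω'
  exact h ω' ω

/-- If `V` is a function of `U`, its entropy is a sum over the values of `U`. -/
theorem ent_comp_eq_sum {U : Ω → β} (hU : IsFinitelyValued U) {R : Finset β}
    (hR : ∀ ω, U ω ∈ R) (f : β → γ) (hV : IsFinitelyValued (fun ω => f (U ω))) :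
    ent μ (fun ω => f (U ω)) =
      -∑ b ∈ R, μ.real (U ⁻¹' {b}) * Real.log (μ.real ((fun ω => f (U ω)) ⁻¹' {f b})) := by
  rw [ent_eq_integral hV,
    integral_comp_eq_sum hU hR (fun b => Real.log (μ.real ((fun ω => f (U ω)) ⁻¹' {f b})))]

theorem sum_measureReal_fiber_inter {U : Ω → β} (hU : IsFinitelyValued U) {R : Finset β}
    (hR : ∀ ω, U ω ∈ R) (s : Set Ω) :
    ∑ b ∈ R, μ.real (U ⁻¹' {b} ∩ s) = μ.real s := by
  have h := sum_measureReal_preimage_singleton (μ := μ.restrict s) R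
    fun b _ => hU.measurableSet_fiber b
  have hpre : U ⁻¹' R = Set.univ := Set.eq_univ_of_forall hR
  simpa only [hpre, measureReal_restrict_apply, hU.measurableSet_fiber, MeasurableSet.univ,
    Set.univ_inter] using h

theorem ent_submodular {U : Ω → β} {V : Ω → γ} {W : Ω → δ} (hU : IsFinitelyValued U)
    (hV : IsFinitelyValued V) (hW : IsFinitelyValued W) :
    ent μ (fun ω => (U ω, V ω, W ω)) + ent μ W ≤
      ent μ (fun ω => (U ω, W ω)) + ent μ (fun ω => (V ω, W ω)) := by
  set S := fun ω => (U ω, V ω, W ω)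
  have hS : IsFinitelyValued S := hU.prodMk (hV.prodMk hW)
  set RU := hU.finite_range.toFinset
  set RV := hV.finite_range.toFinset
  set RW := hW.finite_range.toFinset
  have hRU : ∀ ω, U ω ∈ RU := fun ω => by simp [RU]
  have hRV : ∀ ω, V ω ∈ RV := fun ω => by simp [RV]
  have hRW : ∀ ω, W ω ∈ RW := fun ω => by simp [RW]
  have hR : ∀ ω, S ω ∈ RU ×ˢ RV ×ˢ RW := fun ω => by simp [S, hRU, hRV, hRW]
  set p := fun b : β × γ × δ => μ.real (S ⁻¹' {b})
  set pUW := fun b : β × δ => μ.real ((fun ω => (U ω, W ω)) ⁻¹' {b})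
  set pVW := fun b : γ × δ => μ.real ((fun ω => (V ω, W ω)) ⁻¹' {b})
  set pW := fun w : δ => μ.real (W ⁻¹' {w})
  have e1 : ent μ S = -∑ b ∈ RU ×ˢ RV ×ˢ RW, p b * Real.log (p b) :=
    ent_comp_eq_sum hS hR id hS
  have e2 : ent μ W = -∑ b ∈ RU ×ˢ RV ×ˢ RW, p b * Real.log (pW b.2.2) :=
    ent_comp_eq_sum hS hR (fun b => b.2.2) hW
  have e3 : ent μ (fun ω => (U ω, W ω)) =
    -∑ b ∈ RU ×ˢ RV ×ˢ RW, p b * Real.log (pUW (b.1, b.2.2)) :=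
    ent_comp_eq_sum hS hR (fun b => (b.1, b.2.2)) (hU.prodMk hW)
  have e4 : ent μ (fun ω => (V ω, W ω)) =
    -∑ b ∈ RU ×ˢ RV ×ˢ RW, p b * Real.log (pVW (b.2.1, b.2.2)) :=
    ent_comp_eq_sum hS hR (fun b => (b.2.1, b.2.2)) (hV.prodMk hW)
  have key : ∀ b : β × γ × δ,
      p b * Real.log (pUW (b.1, b.2.2)) + p b * Real.log (pVW (b.2.1, b.2.2))
        - p b * Real.log (p b) - p b * Real.log (pW b.2.2)
      ≤ pUW (b.1, b.2.2) * pVW (b.2.1, b.2.2) / pW b.2.2 - p b := by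
    intro b
    have hnonneg : 0 ≤ p b := measureReal_nonneg
    rcases hnonneg.eq_or_lt with h0 | hpos
    · rw [← h0]
      simp only [zero_mul, add_zero, sub_zero]
      exact div_nonneg (mul_nonneg measureReal_nonneg measureReal_nonneg) measureReal_nonneg
    have h1 : 0 < pUW (b.1, b.2.2) := hpos.trans_le <| measureReal_mono <| by
      rintro ω rfl; rfl
    have h2 : 0 < pVW (b.2.1, b.2.2) := hpos.trans_le <| measureReal_mono <| by
      rintro ω rfl; rfl
    have h3 : 0 < pW b.2.2 := hpos.trans_le <| measureReal_mono <| by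
      rintro ω rfl; rfl
    have hl := Real.log_le_sub_one_of_pos
      (show 0 < pUW (b.1, b.2.2) * pVW (b.2.1, b.2.2) / (p b * pW b.2.2) by positivity)
    rw [Real.log_div (by positivity) (by positivity), Real.log_mul h1.ne' h2.ne',
      Real.log_mul hpos.ne' h3.ne'] at hl
    have hm := mul_le_mul_of_nonneg_left hl hpos.le
    have hr : p b * (pUW (b.1, b.2.2) * pVW (b.2.1, b.2.2) / (p b * pW b.2.2) - 1) =
        pUW (b.1, b.2.2) * pVW (b.2.1, b.2.2) / pW b.2.2 - p b := by
      field_simp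
    linarith
  have hsum := Finset.sum_le_sum fun b (_ : b ∈ RU ×ˢ RV ×ˢ RW) => key b
  simp only [Finset.sum_sub_distrib, Finset.sum_add_distrib] at hsum
  have hpone : ∑ b ∈ RU ×ˢ RV ×ˢ RW, p b = 1 := by
    simpa using sum_measureReal_fiber_inter (μ := μ) hS hR Set.univ
  have hWone : ∑ w ∈ RW, pW w = 1 := by
    simpa using sum_measureReal_fiber_inter (μ := μ) hW hRW Set.univ
  have hUW : ∀ w, ∑ u ∈ RU, pUW (u, w) = pW w := fun w => by
    simp only [pUW, pW, Set.mk_preimage_prod, ← Set.singleton_prod_singleton]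
    exact sum_measureReal_fiber_inter hU hRU (W ⁻¹' {w})
  have hVW : ∀ w, ∑ v ∈ RV, pVW (v, w) = pW w := fun w => by
    simp only [pVW, pW, Set.mk_preimage_prod, ← Set.singleton_prod_singleton]
    exact sum_measureReal_fiber_inter hV hRV (W ⁻¹' {w})
  have hratio : ∑ b ∈ RU ×ˢ RV ×ˢ RW, pUW (b.1, b.2.2) * pVW (b.2.1, b.2.2) / pW b.2.2 = 1 := by
    rw [← hWone, Finset.sum_product]
    simp_rw [Finset.sum_product_right]
    rw [Finset.sum_comm]
    refine Finset.sum_congr rfl fun w _ => ?_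
    simp_rw [← Finset.sum_div]
    rw [← Finset.sum_mul_sum, hUW, hVW, mul_self_div_self]
  rw [e1, e2, e3, e4]
  linarith

theorem ent_of_condIndepRV {U : Ω → β} {V : Ω → γ} {W : Ω → δ} (hU : IsFinitelyValued U)
    (hV : IsFinitelyValued V) (hW : IsFinitelyValued W) (h : CondIndepRV μ U V W) :
    ent μ (fun ω => (U ω, V ω, W ω)) + ent μ W =
      ent μ (fun ω => (U ω, W ω)) + ent μ (fun ω => (V ω, W ω)) := by
  have hS : IsFinitelyValued (fun ω => (U ω, V ω, W ω)) := hU.prodMk (hV.prodMk hW)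
  have hR : ∀ ω, (U ω, V ω, W ω) ∈ hS.finite_range.toFinset :=
    fun ω => hS.finite_range.mem_toFinset.2 ⟨ω, rfl⟩
  have e1 := ent_comp_eq_sum (μ := μ) hS hR id hS
  have e2 := ent_comp_eq_sum (μ := μ) hS hR (fun b => b.2.2) hW
  have e3 := ent_comp_eq_sum (μ := μ) hS hR (fun b => (b.1, b.2.2)) (hU.prodMk hW)
  have e4 := ent_comp_eq_sum (μ := μ) hS hR (fun b => (b.2.1, b.2.2)) (hV.prodMk hW)
  simp only [id] at e1 e2 e3 e4
  rw [e1, e2, e3, e4, ← neg_add, ← neg_add, ← Finset.sum_add_distrib, ← Finset.sum_add_distrib]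
  congr 1
  refine Finset.sum_congr rfl ?_
  rintro ⟨u, v, w⟩ -
  simp only [← Set.singleton_prod_singleton, Set.mk_preimage_prod, ← mul_add]
  have hind := congrArg ENNReal.toReal (h u v w)
  simp only [ENNReal.toReal_mul] at hind
  rw [Set.inter_assoc] at hind
  change μ.real _ * μ.real _ = μ.real _ * μ.real _ at hind
  rcases (measureReal_nonneg :
    0 ≤ μ.real (U ⁻¹' {u} ∩ (V ⁻¹' {v} ∩ W ⁻¹' {w}))).eq_or_lt with h0 | hpos
  · simp [← h0]
  have h1 : 0 < μ.real (W ⁻¹' {w}) := hpos.trans_le <| measureReal_mono fun ω hω => hω.2.2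
  have h2 : 0 < μ.real (U ⁻¹' {u} ∩ W ⁻¹' {w}) :=
    hpos.trans_le <| measureReal_mono fun ω hω => ⟨hω.1, hω.2.2⟩
  have h3 : 0 < μ.real (V ⁻¹' {v} ∩ W ⁻¹' {w}) :=
    hpos.trans_le <| measureReal_mono fun ω hω => hω.2
  rw [← Real.log_mul hpos.ne' h1.ne', hind, Real.log_mul h2.ne' h3.ne']

/-- Conditioning on more information does not increase entropy. -/
theorem condEnt_le_of_determines {U : Ω → β} {V : Ω → γ} {W : Ω → δ} (hU : IsFinitelyValued U)
    (hV : IsFinitelyValued V) (hW : IsFinitelyValued W)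
    (h : ∀ ω ω', V ω = V ω' → W ω = W ω') : condEnt μ U V ≤ condEnt μ U W := by
  have hsub := ent_submodular (μ := μ) hU hV hW
  have h1 : ent μ (fun ω => (U ω, V ω, W ω)) = ent μ (fun ω => (U ω, V ω)) :=
    ent_congr (hU.prodMk (hV.prodMk hW)) (hU.prodMk hV) fun ω ω' => by
      simpa using fun _ => h ω ω'
  have h2 : ent μ (fun ω => (V ω, W ω)) = ent μ V :=
    ent_congr (hV.prodMk hW) hV fun ω ω' => by simpa using h ω ω'
  unfold condEnt
  linarith

/-- If `(U, A)` is conditionally independent of `F` given `W`, then `F` carries no further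
information on `U` once `(A, W)` is known. -/
theorem condEnt_le_of_condIndepRV {α : Type*} {U : Ω → β} {A : Ω → α} {F : Ω → γ} {W : Ω → δ}
    (hU : IsFinitelyValued U) (hA : IsFinitelyValued A) (hF : IsFinitelyValued F)
    (hW : IsFinitelyValued W) (h : CondIndepRV μ (fun ω => (U ω, A ω)) F W) :
    condEnt μ U (fun ω => (A ω, W ω)) ≤ condEnt μ U (fun ω => (A ω, F ω, W ω)) := by
  have hind := ent_of_condIndepRV (hU.prodMk hA) hF hW h
  have hsub := ent_submodular (μ := μ) hA hF hW
  have h1 : ent μ (fun ω => ((U ω, A ω), F ω, W ω)) = ent μ (fun ω => (U ω, A ω, F ω, W ω)) :=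
    ent_congr ((hU.prodMk hA).prodMk (hF.prodMk hW)) (hU.prodMk (hA.prodMk (hF.prodMk hW)))
      fun ω ω' => by simp [and_assoc]
  have h2 : ent μ (fun ω => ((U ω, A ω), W ω)) = ent μ (fun ω => (U ω, A ω, W ω)) :=
    ent_congr ((hU.prodMk hA).prodMk hW) (hU.prodMk (hA.prodMk hW))
      fun ω ω' => by simp [and_assoc]
  unfold condEnt
  linarith

end Entropy

/-- If `(X, Y, Z)` are jointly `d`-Markov, then for every `i ≥ 1` and
every `k ≥ d`, the per-time-step directed information term is bounded by the per-time-step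
truncated directed information term:
`I(X_i ; Y^i ∣ X^{i-1}, Z^i)
  ≤ H(X_i ∣ X_{i-k}^{i-1}, Z_{i-k}^i) - H(X_i ∣ X_{i-k}^{i-1}, Y_{i-k}^i, Z_{i-k}^i)
  = I(X_i ; Y_{i-k}^i ∣ X_{i-k}^{i-1}, Z_{i-k}^i)`. -/
theorem di_term_le_tdi_term
    [MeasurableSpace Ω] (μ : Measure Ω) [IsProbabilityMeasure μ]
    [MeasurableSpace 𝒳] [MeasurableSingletonClass 𝒳] [Fintype 𝒳]
    [MeasurableSpace 𝒴] [MeasurableSingletonClass 𝒴] [Fintype 𝒴]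
    [MeasurableSpace 𝒵] [MeasurableSingletonClass 𝒵] [Fintype 𝒵]
    (X : ℕ → Ω → 𝒳) (Y : ℕ → Ω → 𝒴) (Z : ℕ → Ω → 𝒵)
    (hX : ∀ i, Measurable (X i)) (hY : ∀ i, Measurable (Y i))
    (hZ : ∀ i, Measurable (Z i)) (d : ℕ)
    (hmarkov : JointlyMarkov μ X Y Z d) :
    ∀ (i k : ℕ), 1 ≤ i → d ≤ k →
      (cmi μ (X i) (blk Y 1 i) (fun ω => (blk X 1 (i - 1) ω, blk Z 1 i ω))
          ≤ condEnt μ (X i) (fun ω => (blk X (i - k) (i - 1) ω, blk Z (i - k) i ω))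
            - condEnt μ (X i)
                (fun ω => (blk X (i - k) (i - 1) ω, blk Y (i - k) i ω, blk Z (i - k) i ω)))
      ∧ condEnt μ (X i) (fun ω => (blk X (i - k) (i - 1) ω, blk Z (i - k) i ω))
          - condEnt μ (X i)
              (fun ω => (blk X (i - k) (i - 1) ω, blk Y (i - k) i ω, blk Z (i - k) i ω))
        = cmi μ (X i) (blk Y (i - k) i)
            (fun ω => (blk X (i - k) (i - 1) ω, blk Z (i - k) i ω)) := by
  intro i k hi hdk
  have fX := fun a b => isFinitelyValued_blk hX a b
  have fY := fun a b => isFinitelyValued_blk hY a b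
  have fZ := fun a b => isFinitelyValued_blk hZ a b
  have fx := IsFinitelyValued.of_measurable (hX i)
  have fA := (IsFinitelyValued.of_measurable (hY i)).prodMk
    (IsFinitelyValued.of_measurable (hZ i))
  have fF := (fX 1 (i - d - 1)).prodMk ((fY 1 (i - d - 1)).prodMk (fZ 1 (i - d - 1)))
  have fP : IsFinitelyValued (past X Y Z d i) :=
    (fX (i - d) (i - 1)).prodMk ((fY (i - d) (i - 1)).prodMk (fZ (i - d) (i - 1)))
  have fK := (fX (i - k) (i - 1)).prodMk ((fY (i - k) i).prodMk (fZ (i - k) i))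
  have fK' := (fY (i - k) i).prodMk ((fX (i - k) (i - 1)).prodMk (fZ (i - k) i))
  constructor
  · have hfull := condEnt_le_of_determines (μ := μ) fx ((fX 1 (i - 1)).prodMk (fZ 1 i))
      ((fX (i - k) (i - 1)).prodMk (fZ (i - k) i)) fun ω ω' h => by
        simp only [Prod.mk.injEq, blk_eq_iff] at h ⊢
        exact ⟨fun j _ _ => h.1 j (by omega) (by omega), fun j _ _ => h.2 j (by omega) (by omega)⟩
    have hwindow := condEnt_le_of_determines (μ := μ) fx fK (fA.prodMk fP) fun ω ω' h => by
        simp only [past, Prod.mk.injEq, blk_eq_iff] at h ⊢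
        obtain ⟨h1, h2, h3⟩ := h
        exact ⟨⟨h2 i (by omega) le_rfl, h3 i (by omega) le_rfl⟩,
          fun j _ _ => h1 j (by omega) (by omega), fun j _ _ => h2 j (by omega) (by omega),
          fun j _ _ => h3 j (by omega) (by omega)⟩
    have hmid := condEnt_le_of_condIndepRV fx fA fF fP (hmarkov i hi)
    have hpast := condEnt_le_of_determines (μ := μ) fx (fA.prodMk (fF.prodMk fP))
      ((fY 1 i).prodMk ((fX 1 (i - 1)).prodMk (fZ 1 i))) fun ω ω' h => by
        simp only [past, Prod.mk.injEq, blk_eq_iff] at h ⊢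
        obtain ⟨⟨hy, hz⟩, ⟨f1, f2, f3⟩, p1, p2, p3⟩ := h
        refine ⟨fun j _ _ => ?_, fun j _ _ => ?_, fun j _ _ => ?_⟩
        · rcases eq_or_ne j i with rfl | hj
          · exact hy
          by_cases hf : j ≤ i - d - 1
          · exact f2 j (by omega) hf
          · exact p2 j (by omega) (by omega)
        · by_cases hf : j ≤ i - d - 1
          · exact f1 j (by omega) hf
          · exact p1 j (by omega) (by omega)
        · rcases eq_or_ne j i with rfl | hj
          · exact hz
          by_cases hf : j ≤ i - d - 1
          · exact f3 j (by omega) hf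
          · exact p3 j (by omega) (by omega)
    unfold cmi
    linarith
  · unfold cmi
    congr 1
    apply le_antisymm
    · exact condEnt_le_of_determines fx fK fK' fun ω ω' h => by
        simp only [Prod.mk.injEq] at h ⊢
        tauto
    · exact condEnt_le_of_determines fx fK' fK fun ω ω' h => by
        simp only [Prod.mk.injEq] at h ⊢
        tauto
end
end

section
/- Let A be an n × n real matrix whose rows each sum to 1, such that I − A has rank n − 1, and suppose that the common row r of adj(I − A) has nonzero entry sum s = Σ_j r_j ≠ 0. Then π defined by π_j = adj(I − A)_{1,j} / Σ_k adj(I − A)_{1,k} (any fixed row index may be used in place of 1) is the unique real row vector satisfying π A = π and Σ_j π_j = 1. In particular, each coordinate of π is a ratio of two polynomial functions of the entries of A. -/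
open Matrix

/-- A square matrix whose rows all sum to zero is singular. -/
theorem det_eq_zero_of_row_sum_eq_zero {n : ℕ} (hn : 1 ≤ n) {M : Matrix (Fin n) (Fin n) ℝ}
    (hM : ∀ i, ∑ j, M i j = 0) : M.det = 0 := by
  refine Matrix.exists_mulVec_eq_zero_iff.mp ⟨fun _ => 1, ?_, ?_⟩
  · exact fun h => one_ne_zero (congrFun h ⟨0, hn⟩)
  · ext i
    simpa [Matrix.mulVec, dotProduct] using hM i

/-- Each row of the adjugate of a singular matrix lies in its left kernel. -/
theorem adjugate_row_vecMul_eq_zero {n : ℕ} {M : Matrix (Fin n) (Fin n) ℝ}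
    (hM : M.det = 0) (i : Fin n) : M.adjugate i ᵥ* M = 0 := by
  have h : M.adjugate * M = 0 := by rw [Matrix.adjugate_mul, hM, zero_smul]
  exact congrFun h i

/-- If `M` has corank one, its left kernel is spanned by any nonzero vector in it. -/
theorem exists_smul_eq_of_vecMul_eq_zero {n : ℕ} (hn : 1 ≤ n) {M : Matrix (Fin n) (Fin n) ℝ}
    (hM : M.rank = n - 1) {v w : Fin n → ℝ} (hv : v ≠ 0) (hvM : v ᵥ* M = 0)
    (hwM : w ᵥ* M = 0) : ∃ c : ℝ, c • v = w := by
  have hker : Module.finrank ℝ (LinearMap.ker Mᵀ.mulVecLin) = 1 := by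
    have h := Mᵀ.mulVecLin.finrank_range_add_finrank_ker
    change Mᵀ.rank + _ = _ at h
    rw [Matrix.rank_transpose, hM, Module.finrank_fin_fun] at h
    omega
  have hmem : ∀ {u : Fin n → ℝ}, u ᵥ* M = 0 → u ∈ LinearMap.ker Mᵀ.mulVecLin := fun hu => by
    rw [LinearMap.mem_ker, Matrix.mulVecLin_apply, Matrix.mulVec_transpose, hu]
  obtain ⟨c, hc⟩ := (finrank_eq_one_iff_of_nonzero' ⟨v, hmem hvM⟩
    (fun h => hv (congrArg Subtype.val h))).mp hker ⟨w, hmem hwM⟩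
  exact ⟨c, congrArg Subtype.val hc⟩

/-- Let `A` be an `n × n` real matrix whose rows each sum to `1`, with
`1 - A` of rank `n - 1`, whose adjugate `adj(1 - A)` has all rows equal (the common row),
and suppose the entries of the common row have nonzero sum. Then
`π_j = adj(1 - A)_{0 j} / ∑_k adj(1 - A)_{0 k}` is the unique real row vector satisfying
`π * A = π` and `∑_j π_j = 1`. -/
theorem invariant_distribution_via_adjugate (n : ℕ) (hn : 1 ≤ n)
    (A : Matrix (Fin n) (Fin n) ℝ)
    (hrow : ∀ i, ∑ j, A i j = 1)
    (hrank : (1 - A).rank = n - 1)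
    (hrows : ∀ i i' j, (1 - A).adjugate i j = (1 - A).adjugate i' j)
    (hs : ∑ j, (1 - A).adjugate ⟨0, hn⟩ j ≠ 0) :
    (fun j => (1 - A).adjugate ⟨0, hn⟩ j / ∑ k, (1 - A).adjugate ⟨0, hn⟩ k) ᵥ* A
        = (fun j => (1 - A).adjugate ⟨0, hn⟩ j / ∑ k, (1 - A).adjugate ⟨0, hn⟩ k) ∧
    (∑ j, (1 - A).adjugate ⟨0, hn⟩ j / ∑ k, (1 - A).adjugate ⟨0, hn⟩ k) = 1 ∧
    ∀ π' : Fin n → ℝ, π' ᵥ* A = π' → ∑ j, π' j = 1 →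
      π' = fun j => (1 - A).adjugate ⟨0, hn⟩ j / ∑ k, (1 - A).adjugate ⟨0, hn⟩ k := by
  have hdet : (1 - A).det = 0 := det_eq_zero_of_row_sum_eq_zero hn fun i => by
    simp [Finset.sum_sub_distrib, hrow, Matrix.one_apply]
  have hr := adjugate_row_vecMul_eq_zero hdet ⟨0, hn⟩
  set r := (1 - A).adjugate ⟨0, hn⟩
  have hπ : (fun j => r j / ∑ k, r k) = (∑ k, r k)⁻¹ • r := by
    ext j
    simp [div_eq_inv_mul]
  refine ⟨?_, ?_, fun π' hinv hsum => ?_⟩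
  · have hrA : r ᵥ* A = r := by
      rw [Matrix.vecMul_sub, Matrix.vecMul_one, sub_eq_zero] at hr
      exact hr.symm
    rw [hπ, Matrix.smul_vecMul, hrA]
  · rw [← Finset.sum_div, div_self hs]
  · have hr0 : r ≠ 0 := fun h => hs (by simp [h])
    obtain ⟨c, rfl⟩ := exists_smul_eq_of_vecMul_eq_zero hn hrank hr0 hr
      (w := π') (by rw [Matrix.vecMul_sub, Matrix.vecMul_one, hinv, sub_self])
    have hc : c * ∑ k, r k = 1 := by simpa [Finset.mul_sum] using hsum
    rw [hπ, eq_inv_of_mul_eq_one_left hc]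
end
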